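/- Let A, B ∈ ℂ^{n₁×n₁×n₃} satisfy A ⋆ B² = B² ⋆ A = B ⋆ A ⋆ B, let k = max{ind(A), ind(B)}, and let A^{GD} and B^{GD} be GD inverses of A and B satisfying the GD equations with exponent k. If A ⋆ B ⋆ B^{GD} = B ⋆ B^{GD} ⋆ A and B ⋆ B^{GD} ⋆ A^{GD} = A^{GD} ⋆ B ⋆ B^{GD}, then B^{GD} ⋆ A^{GD} is a GD inverse of A ⋆ B with exponent k; that is, (A⋆B) ⋆ (B^{GD}⋆A^{GD}) ⋆ (A⋆B) = A⋆B, (B^{GD}⋆A^{GD}) ⋆ (A⋆B)^{k+1} = (A⋆B)^k, and (A⋆B)^{k+1} ⋆ (B^{GD}⋆A^{GD}) = (A⋆B)^k. -/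

import Mathlib

open Matrix BigOperators

/-- A third-order complex tensor in `ℂ^{n₁ × n₂ × n₃}`, given by its frontal slices. -/
abbrev Tensor3 (n₁ n₂ n₃ : ℕ) := Fin n₃ → Matrix (Fin n₁) (Fin n₂) ℂ

/-- Mode-3 product of a tensor with an `n₃ × n₃` matrix: the slices of the result are the
indicated linear combinations of the slices of `A`. -/
noncomputable def mode3 {n₁ n₂ n₃ : ℕ} (M : Matrix (Fin n₃) (Fin n₃) ℂ) (A : Tensor3 n₁ n₂ n₃) :
    Tensor3 n₁ n₂ n₃ :=
  fun i => ∑ j, M i j • A j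

/-- The M-product `A ⋆_M B`: slice-wise matrix product in the transformed (hat) domain,
transformed back by `M⁻¹`. -/
noncomputable def mprod {n₁ n₂ l n₃ : ℕ} (M : Matrix (Fin n₃) (Fin n₃) ℂ)
    (A : Tensor3 n₁ n₂ n₃) (B : Tensor3 n₂ l n₃) : Tensor3 n₁ l n₃ :=
  mode3 M⁻¹ (fun i => mode3 M A i * mode3 M B i)

/-- The identity tensor: every slice of its mode-3 transform is the identity matrix. -/
noncomputable def idT (n₁ : ℕ) {n₃ : ℕ} (M : Matrix (Fin n₃) (Fin n₃) ℂ) : Tensor3 n₁ n₁ n₃ :=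
  mode3 M⁻¹ (fun _ => (1 : Matrix (Fin n₁) (Fin n₁) ℂ))

/-- Powers of a square tensor with respect to the M-product. -/
noncomputable def mpow {n₁ n₃ : ℕ} (M : Matrix (Fin n₃) (Fin n₃) ℂ) (A : Tensor3 n₁ n₁ n₃) :
    ℕ → Tensor3 n₁ n₁ n₃
  | 0 => idT n₁ M
  | k + 1 => mprod M (mpow M A k) A

/-- Conjugate transpose with respect to the M-product: slice-wise conjugate transpose in the
transformed domain. -/
noncomputable def ctrans {n₁ n₂ n₃ : ℕ} (M : Matrix (Fin n₃) (Fin n₃) ℂ) (A : Tensor3 n₁ n₂ n₃) :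
    Tensor3 n₂ n₁ n₃ :=
  mode3 M⁻¹ (fun i => (mode3 M A i)ᴴ)

/-- Index of a square complex matrix: the least `k ≥ 0` with `rank(B^k) = rank(B^{k+1})`. -/
noncomputable def matIndex {n : ℕ} (B : Matrix (Fin n) (Fin n) ℂ) : ℕ :=
  sInf {k : ℕ | (B ^ k).rank = (B ^ (k + 1)).rank}

/-- Index of a tensor: the maximum of the indices of the slices of its mode-3 transform. -/
noncomputable def tIndex {n₁ n₃ : ℕ} (M : Matrix (Fin n₃) (Fin n₃) ℂ)
    (A : Tensor3 n₁ n₁ n₃) : ℕ :=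
  Finset.univ.sup fun i => matIndex (mode3 M A i)

/-- `X` is a GD inverse of `A` with exponent `k`:
`A ⋆ X ⋆ A = A`, `X ⋆ A^{k+1} = A^k`, `A^{k+1} ⋆ X = A^k`. -/
def IsGD {n₁ n₃ : ℕ} (M : Matrix (Fin n₃) (Fin n₃) ℂ) (A X : Tensor3 n₁ n₁ n₃)
    (k : ℕ) : Prop :=
  mprod M (mprod M A X) A = A ∧
  mprod M X (mpow M A (k + 1)) = mpow M A k ∧
  mprod M (mpow M A (k + 1)) X = mpow M A k

/-- `X` is the Drazin inverse of `A` with exponent `k`. -/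
def IsDrazin {n₁ n₃ : ℕ} (M : Matrix (Fin n₃) (Fin n₃) ℂ) (A X : Tensor3 n₁ n₁ n₃)
    (k : ℕ) : Prop :=
  mprod M X (mpow M A (k + 1)) = mpow M A k ∧
  mprod M (mprod M X A) X = X ∧
  mprod M X A = mprod M A X

/-- `X` is the Moore–Penrose inverse of `A`. -/
def IsMP {n₁ n₃ : ℕ} (M : Matrix (Fin n₃) (Fin n₃) ℂ) (A X : Tensor3 n₁ n₁ n₃) : Prop :=
  mprod M (mprod M A X) A = A ∧
  mprod M (mprod M X A) X = X ∧
  ctrans M (mprod M A X) = mprod M A X ∧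
  ctrans M (mprod M X A) = mprod M X A

section Monoid

variable {R : Type*} [Monoid R]

/-- `x` is a GD inverse of `a` with exponent `k` in a monoid. -/
def IsGDInverse (a x : R) (k : ℕ) : Prop :=
  a * x * a = a ∧ x * a ^ (k + 1) = a ^ k ∧ a ^ (k + 1) * x = a ^ k

theorem commute_pow_add_two {a b : R} (h₁ : a * b ^ 2 = b ^ 2 * a)
    (h₂ : b ^ 2 * a = b * a * b) (n : ℕ) : Commute a (b ^ (n + 2)) := by
  induction n with
  | zero => exact h₁
  | succ n ih =>
    calc a * b ^ (n + 2 + 1) = a * b ^ 2 * b ^ (n + 1) := by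
          rw [mul_assoc, ← pow_add, show n + 2 + 1 = 2 + (n + 1) by omega]
      _ = b * (a * b ^ (n + 2)) := by rw [h₁, h₂, pow_succ' b (n + 1)]; simp only [mul_assoc]
      _ = b ^ (n + 2 + 1) * a := by rw [ih.eq, pow_succ' b (n + 2), mul_assoc]

theorem mul_pow_of_mul_sq_eq {a b : R} (h₁ : a * b ^ 2 = b ^ 2 * a)
    (h₂ : b ^ 2 * a = b * a * b) (n : ℕ) : (a * b) ^ n = a ^ n * b ^ n := by
  rcases n with _ | n
  · simp
  induction n with
  | zero => simp
  | succ n ih =>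
    rw [pow_succ (a * b), ih]
    rcases n with _ | n
    · simp only [zero_add, pow_one, pow_two] at *
      calc a * b * (a * b) = a * (b * a * b) := by simp only [mul_assoc]
        _ = a * a * (b * b) := by rw [← h₂, ← h₁, mul_assoc]
        _ = a ^ (1 + 1) * b ^ (1 + 1) := by simp only [pow_succ, pow_zero, one_mul]
    · rw [mul_assoc, ← mul_assoc (b ^ _), ← (commute_pow_add_two h₁ h₂ n).eq,
        pow_succ a (n + 1 + 1), pow_succ b (n + 1 + 1)]
      simp only [mul_assoc]

/-- Small exponents force `a` and `b` to commute; larger powers of `b` commute with `a` anyway. -/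
theorem IsGDInverse.commute_pow {a b y : R} {k : ℕ} (hb : IsGDInverse b y k)
    (h₁ : a * b ^ 2 = b ^ 2 * a) (h₂ : b ^ 2 * a = b * a * b)
    (h : a * b * y = b * y * a) {n : ℕ} (hn : k ≤ n) : Commute a (b ^ n) := by
  rcases n with _ | _ | n
  · simp
  · have hsq : b ^ 2 * y = b := by
      have := hb.2.2
      interval_cases k
      · simp_all [pow_two, mul_assoc]
      · simpa using this
    rw [zero_add, pow_one]
    calc a * b = a * b ^ 2 * y := by rw [mul_assoc, hsq]
      _ = b * (a * b * y) := by rw [h₁, h₂]; simp only [mul_assoc]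
      _ = b ^ 2 * y * a := by rw [h, pow_two]; simp only [mul_assoc]
      _ = b * a := by rw [hsq]
  · exact commute_pow_add_two h₁ h₂ n

theorem IsGDInverse.mul {a b x y : R} {k : ℕ} (ha : IsGDInverse a x k)
    (hb : IsGDInverse b y k) (h₁ : a * b ^ 2 = b ^ 2 * a) (h₂ : b ^ 2 * a = b * a * b)
    (h : a * b * y = b * y * a) (hx : b * y * x = x * b * y) :
    IsGDInverse (a * b) (y * x) k := by
  have ck := hb.commute_pow h₁ h₂ h le_rfl
  have ck' := hb.commute_pow h₁ h₂ h k.le_succ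
  refine ⟨?_, ?_, ?_⟩
  · calc a * b * (y * x) * (a * b) = a * (b * y * x) * (a * b) := by simp only [mul_assoc]
      _ = a * x * (b * y * a) * b := by rw [hx]; simp only [mul_assoc]
      _ = a * x * a * (b * y * b) := by rw [← h]; simp only [mul_assoc]
      _ = a * b := by rw [ha.1, hb.1]
  · calc y * x * (a * b) ^ (k + 1) = y * (x * a ^ (k + 1)) * b ^ (k + 1) := by
          rw [mul_pow_of_mul_sq_eq h₁ h₂]; simp only [mul_assoc]
      _ = y * b ^ (k + 1) * a ^ k := by
          rw [ha.2.1, mul_assoc, (ck'.pow_left k).eq, mul_assoc]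
      _ = (a * b) ^ k := by
          rw [hb.2.1, ← (ck.pow_left k).eq, mul_pow_of_mul_sq_eq h₁ h₂]
  · calc (a * b) ^ (k + 1) * (y * x) = a ^ (k + 1) * (b ^ (k + 1) * y) * x := by
          rw [mul_pow_of_mul_sq_eq h₁ h₂]; simp only [mul_assoc]
      _ = b ^ k * (a ^ (k + 1) * x) := by
          rw [hb.2.2, (ck.pow_left (k + 1)).eq, mul_assoc]
      _ = (a * b) ^ k := by
          rw [ha.2.2, ← (ck.pow_left k).eq, mul_pow_of_mul_sq_eq h₁ h₂]

end Monoid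

section Transform

variable {n₁ n₂ n₃ : ℕ} {M : Matrix (Fin n₃) (Fin n₃) ℂ}

theorem mode3_one (A : Tensor3 n₁ n₂ n₃) : mode3 1 A = A := by
  funext i
  simp [mode3, Matrix.one_apply]

theorem mode3_mode3 (M N : Matrix (Fin n₃) (Fin n₃) ℂ) (A : Tensor3 n₁ n₂ n₃) :
    mode3 M (mode3 N A) = mode3 (M * N) A := by
  funext i
  simp only [mode3, Matrix.mul_apply, Finset.smul_sum, Finset.sum_smul, smul_smul]
  exact Finset.sum_comm

theorem mode3_mode3_inv (hM : IsUnit M) (A : Tensor3 n₁ n₂ n₃) :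
    mode3 M (mode3 M⁻¹ A) = A := by
  rw [mode3_mode3, Matrix.mul_nonsing_inv _ ((Matrix.isUnit_iff_isUnit_det M).1 hM), mode3_one]

theorem mode3_injective (hM : IsUnit M) :
    Function.Injective (mode3 M : Tensor3 n₁ n₂ n₃ → Tensor3 n₁ n₂ n₃) :=
  Function.LeftInverse.injective (g := mode3 M⁻¹) fun A => by
    rw [mode3_mode3, Matrix.nonsing_inv_mul _ ((Matrix.isUnit_iff_isUnit_det M).1 hM), mode3_one]

theorem mode3_mprod (hM : IsUnit M) (A B : Tensor3 n₁ n₁ n₃) :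
    mode3 M (mprod M A B) = mode3 M A * mode3 M B :=
  mode3_mode3_inv hM _

theorem mode3_mpow (hM : IsUnit M) (A : Tensor3 n₁ n₁ n₃) (k : ℕ) :
    mode3 M (mpow M A k) = mode3 M A ^ k := by
  induction k with
  | zero => exact mode3_mode3_inv hM _
  | succ k ih => rw [mpow, mode3_mprod hM, ih, pow_succ]

theorem isGD_iff (hM : IsUnit M) (A X : Tensor3 n₁ n₁ n₃) (k : ℕ) :
    IsGD M A X k ↔ IsGDInverse (mode3 M A) (mode3 M X) k := by
  rw [IsGD, ← (mode3_injective hM).eq_iff, ← (mode3_injective hM).eq_iff (b := mpow M A k),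
    ← (mode3_injective hM).eq_iff (b := mpow M A k)]
  simp only [IsGDInverse, mode3_mprod hM, mode3_mpow hM]

end Transform

/-- reverse order law for the GD inverse under the condition
`A ⋆ B² = B² ⋆ A = B ⋆ A ⋆ B`. -/
theorem gd_reverse_order_law_one {n₁ n₃ : ℕ} (hn₁ : 0 < n₁) (hn₃ : 0 < n₃)
    (M : Matrix (Fin n₃) (Fin n₃) ℂ) (hM : IsUnit M)
    (A B AGD BGD : Tensor3 n₁ n₁ n₃) (k : ℕ)
    (hcomm₁ : mprod M A (mpow M B 2) = mprod M (mpow M B 2) A)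
    (hcomm₂ : mprod M (mpow M B 2) A = mprod M (mprod M B A) B)
    (hk : k = max (tIndex M A) (tIndex M B))
    (hAGD : IsGD M A AGD k) (hBGD : IsGD M B BGD k)
    (h1 : mprod M (mprod M A B) BGD = mprod M (mprod M B BGD) A)
    (h2 : mprod M (mprod M B BGD) AGD = mprod M (mprod M AGD B) BGD) :
    IsGD M (mprod M A B) (mprod M BGD AGD) k := by
  rw [isGD_iff hM] at hAGD hBGD ⊢
  have h₁ := congrArg (mode3 M) hcomm₁
  have h₂ := congrArg (mode3 M) hcomm₂
  have h := congrArg (mode3 M) h1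
  have hx := congrArg (mode3 M) h2
  simp only [mode3_mprod hM, mode3_mpow hM] at h₁ h₂ h hx ⊢
  exact hAGD.mul hBGD h₁ h₂ h hx
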